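/- Let G be a finite group and ρ₁, ρ₂ : G → GL(n, ℂ) be two inequivalent (non-isomorphic) finite-dimensional complex representations of G. Then the number of elements g ∈ G at which the characters agree, Tr(ρ₁(g)) = Tr(ρ₂(g)), is at most (1 - 1/(2n²))·|G|. -/

import Mathlib

open Module

namespace Representation

section Decomposition

variable {k G V W : Type*} [Field k] [Group G]
  [AddCommGroup V] [Module k V] [AddCommGroup W] [Module k W]
  {ρ : Representation k G V} {σ : Representation k G W}

theorem isCompl_toSubmodule {S T : Subrepresentation ρ} (h : IsCompl S T) :
    IsCompl S.toSubmodule T.toSubmodule := by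
  refine ⟨disjoint_iff.2 ?_, codisjoint_iff.2 ?_⟩
  · exact congrArg Subrepresentation.toSubmodule h.inf_eq_bot
  · exact congrArg Subrepresentation.toSubmodule h.sup_eq_top

/-- A representation is the product of two complementary subrepresentations. -/
noncomputable def prodEquivOfIsCompl {S T : Subrepresentation ρ} (h : IsCompl S T) :
    (S.toRepresentation.prod T.toRepresentation).Equiv ρ :=
  Equiv.mk (Submodule.prodEquivOfIsCompl _ _ (isCompl_toSubmodule h)) fun g => by
    refine LinearMap.ext fun x => ?_
    exact (map_add (ρ g) (x.1 : V) x.2).symm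

theorem character_eq_add_of_isCompl [FiniteDimensional k V] {S T : Subrepresentation ρ}
    (h : IsCompl S T) (g : G) :
    ρ.character g = S.toRepresentation.character g + T.toRepresentation.character g := by
  rw [← char_iso (prodEquivOfIsCompl h)]
  exact LinearMap.trace_prodMap' _ _

/-- A complement of the kernel of an intertwining map is equivalent to its range. -/
noncomputable def kerComplementEquivRange (f : IntertwiningMap ρ σ) {C : Subrepresentation ρ}
    (h : IsCompl C f.ker) : C.toRepresentation.Equiv f.range.toRepresentation :=
  Equiv.mk (f.toLinearMap.kerComplementEquivRange (isCompl_toSubmodule h)) fun g => by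
    refine LinearMap.ext fun x => Subtype.ext ?_
    exact IntertwiningMap.isIntertwining _ _ f g x

theorem nonempty_equiv_of_isCompl {S T : Subrepresentation ρ} {S' T' : Subrepresentation σ}
    (h : IsCompl S T) (h' : IsCompl S' T')
    (e : S.toRepresentation.Equiv S'.toRepresentation)
    (e' : T.toRepresentation.Equiv T'.toRepresentation) : Nonempty (ρ.Equiv σ) := by
  let p : (S.toRepresentation.prod T.toRepresentation).Equiv
      (S'.toRepresentation.prod T'.toRepresentation) :=
    Equiv.mk (e.toLinearEquiv.prodCongr e'.toLinearEquiv) fun g => by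
      refine LinearMap.ext fun x => Prod.ext ?_ ?_
      · exact IntertwiningMap.isIntertwining _ _ e.toIntertwiningMap g x.1
      · exact IntertwiningMap.isIntertwining _ _ e'.toIntertwiningMap g x.2
  exact ⟨((prodEquivOfIsCompl h).symm.trans p).trans (prodEquivOfIsCompl h')⟩

theorem one_le_finrank_intertwiningMap_self [FiniteDimensional k V] [Nontrivial V]
    (ρ : Representation k G V) :
    1 ≤ finrank k (IntertwiningMap ρ ρ) := by
  have : FiniteDimensional k (IntertwiningMap ρ ρ) :=
    Module.Finite.equiv (invariantsEquivIntertwiningMap ρ ρ)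
  have : Nontrivial (IntertwiningMap ρ ρ) := by
    obtain ⟨v, hv⟩ := exists_ne (0 : V)
    exact ⟨IntertwiningMap.id ρ, 0, fun h => hv (DFunLike.congr_fun h v)⟩
  exact finrank_pos

end Decomposition

section CharacterDistance

variable {k G : Type*} [Field k] [CharZero k] [Group G] [Fintype G]

theorem sum_char_mul_char_inv {V W : Type*} [AddCommGroup V] [Module k V] [FiniteDimensional k V]
    [AddCommGroup W] [Module k W] [FiniteDimensional k W]
    (ρ : Representation k G V) (σ : Representation k G W) :
    ∑ g : G, σ.character g * ρ.character g⁻¹ =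
      (Fintype.card G : k) * finrank k (IntertwiningMap ρ σ) := by
  have h0 : (Nat.card G : k) ≠ 0 := Nat.cast_ne_zero.2 Nat.card_pos.ne'
  let : Invertible (Nat.card G : k) := invertibleOfNonzero h0
  rw [← card_inv_mul_sum_char_mul_char_eq_finrank ρ σ, Fintype.card_eq_nat_card,
    mul_inv_cancel_left₀ h0]

/-- The characters of two inequivalent representations of the same dimension are at squared
distance at least `2`. -/
theorem exists_two_le_sum_sub_mul_sub_inv {V W : Type*}
    [AddCommGroup V] [Module k V] [FiniteDimensional k V]
    [AddCommGroup W] [Module k W] [FiniteDimensional k W]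
    (ρ : Representation k G V) (σ : Representation k G W)
    (hdim : finrank k V = finrank k W) (hne : IsEmpty (ρ.Equiv σ)) :
    ∃ m : ℕ, 2 ≤ m ∧ ∑ g : G, (ρ.character g - σ.character g) *
      (ρ.character g⁻¹ - σ.character g⁻¹) = (Fintype.card G : k) * m := by
  induction hd : finrank k V using Nat.strong_induction_on generalizing V W with
  | _ d ih =>
  have : NeZero (Nat.card G : k) := ⟨Nat.cast_ne_zero.2 Nat.card_pos.ne'⟩
  by_cases hf : ∃ f : IntertwiningMap ρ σ, f ≠ 0
  · obtain ⟨f, hf⟩ := hf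
    obtain ⟨C, hC⟩ := exists_isCompl f.ker
    obtain ⟨D, hD⟩ := exists_isCompl f.range
    let e := kerComplementEquivRange f hC.symm
    have hrank := f.toLinearMap.finrank_range_add_finrank_ker
    have hrange : 0 < finrank k (LinearMap.range f.toLinearMap) := by
      refine Nat.pos_of_ne_zero fun h => hf (IntertwiningMap.ext ?_)
      exact LinearMap.range_eq_bot.1 (Submodule.finrank_eq_zero.1 h)
    have hsum := Submodule.finrank_add_eq_of_isCompl (isCompl_toSubmodule hD)
    change finrank k (LinearMap.range f.toLinearMap) + _ = _ at hsum
    obtain ⟨m, hm, h⟩ := ih (finrank k (LinearMap.ker f.toLinearMap)) (by omega)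
      f.ker.toRepresentation D.toRepresentation
      (show finrank k (LinearMap.ker f.toLinearMap) = _ by omega)
      ⟨fun e' => (nonempty_equiv_of_isCompl hC.symm hD e e').elim hne.elim⟩ rfl
    refine ⟨m, hm, h ▸ Finset.sum_congr rfl fun g _ => ?_⟩
    simp only [character_eq_add_of_isCompl hC, character_eq_add_of_isCompl hD, ← char_iso e]
    ring
  · push Not at hf
    have hV : Nontrivial V := by
      by_contra h
      rw [not_nontrivial_iff_subsingleton] at h
      have : Subsingleton W := by
        rw [← finrank_zero_iff (R := k), ← hdim, finrank_zero_iff]; exact h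
      exact hne.elim (Equiv.mk 0 fun g => LinearMap.ext fun x => Subsingleton.elim _ _)
    have hW : Nontrivial W := finrank_pos_iff.1 (hdim ▸ finrank_pos (R := k) (M := V))
    have : Subsingleton (IntertwiningMap ρ σ) := ⟨fun a b => (hf a).trans (hf b).symm⟩
    have h₁ := sum_char_mul_char_inv ρ σ
    rw [finrank_zero_of_subsingleton, Nat.cast_zero, mul_zero] at h₁
    have h₂ : ∑ g : G, ρ.character g * σ.character g⁻¹ = 0 := by
      rw [← h₁, ← Equiv.sum_comp (Equiv.inv G)]
      exact Finset.sum_congr rfl fun g _ => by simp [mul_comm]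
    refine ⟨finrank k (IntertwiningMap ρ ρ) + finrank k (IntertwiningMap σ σ),
      add_le_add (one_le_finrank_intertwiningMap_self ρ) (one_le_finrank_intertwiningMap_self σ),
      ?_⟩
    rw [Nat.cast_add, mul_add, ← sum_char_mul_char_inv ρ ρ, ← sum_char_mul_char_inv σ σ]
    simp only [sub_mul, mul_sub, Finset.sum_sub_distrib, h₁, h₂]
    ring

end CharacterDistance

end Representation

theorem Matrix.norm_trace_le_of_pow_eq_one {n m : ℕ} {M : Matrix (Fin n) (Fin n) ℂ}
    (hm : m ≠ 0) (h : M ^ m = 1) : ‖M.trace‖ ≤ n := by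
  have hroot : ∀ μ ∈ M.charpoly.roots, ‖μ‖ = 1 := by
    intro μ hμ
    have hs := spectrum.pow_mem_pow M m
      (Matrix.mem_spectrum_of_isRoot_charpoly (Polynomial.isRoot_of_mem_roots hμ))
    cases isEmpty_or_nonempty (Fin n)
    · rw [spectrum.of_subsingleton] at hs
      exact hs.elim
    · rw [h, spectrum.one_eq, Set.mem_singleton_iff] at hs
      exact Complex.norm_eq_one_of_pow_eq_one hs hm
  rw [Matrix.trace_eq_sum_roots_charpoly]
  calc ‖M.charpoly.roots.sum‖ ≤ (M.charpoly.roots.map fun μ => ‖μ‖).sum :=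
        norm_multiset_sum_le _
    _ = (M.charpoly.roots.map fun _ => (1 : ℝ)).sum := by rw [Multiset.map_congr rfl hroot]
    _ = (Multiset.card M.charpoly.roots : ℝ) := by simp
    _ ≤ n := by
        exact_mod_cast (Polynomial.card_roots' _).trans
          (by simp [Matrix.charpoly_natDegree_eq_dim])

/-- The representation on `Fin n → k` attached to a homomorphism into `GL n k`. -/
noncomputable def Representation.ofGeneralLinearGroup {k G : Type*} [Field k] [Group G] {n : ℕ}
    (ρ : G →* Matrix.GeneralLinearGroup (Fin n) k) : Representation k G (Fin n → k) :=
  (Matrix.toLinAlgEquiv' : Matrix (Fin n) (Fin n) k ≃ₐ[k] _).toAlgHom.toMonoidHom.comp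
    ((Units.coeHom _).comp ρ)

namespace Representation

variable {k G : Type*} [Field k] [Group G] {n : ℕ}

theorem ofGeneralLinearGroup_apply (ρ : G →* Matrix.GeneralLinearGroup (Fin n) k) (g : G) :
    ofGeneralLinearGroup ρ g = Matrix.toLin' (ρ g : Matrix (Fin n) (Fin n) k) :=
  rfl

theorem character_ofGeneralLinearGroup (ρ : G →* Matrix.GeneralLinearGroup (Fin n) k) (g : G) :
    (ofGeneralLinearGroup ρ).character g = Matrix.trace (ρ g : Matrix (Fin n) (Fin n) k) :=
  Matrix.trace_toLin'_eq _

theorem exists_conj_of_equiv_ofGeneralLinearGroup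
    {ρ₁ ρ₂ : G →* Matrix.GeneralLinearGroup (Fin n) k}
    (e : (ofGeneralLinearGroup ρ₁).Equiv (ofGeneralLinearGroup ρ₂)) :
    ∃ M : Matrix.GeneralLinearGroup (Fin n) k, ∀ g : G, ρ₂ g = M * ρ₁ g * M⁻¹ := by
  let M : Matrix.GeneralLinearGroup (Fin n) k :=
    Matrix.GeneralLinearGroup.toLin.symm (LinearMap.GeneralLinearGroup.ofLinearEquiv e.toLinearEquiv)
  have hM : Matrix.toLin' (M : Matrix (Fin n) (Fin n) k) = e.toLinearMap := by
    exact Matrix.toLin'_toMatrix' _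
  refine ⟨M, fun g => ?_⟩
  rw [eq_mul_inv_iff_mul_eq]
  refine Units.ext (Matrix.toLin'.injective ?_)
  rw [Units.val_mul, Units.val_mul, Matrix.toLin'_mul, Matrix.toLin'_mul, hM]
  exact (e.toIntertwiningMap.isIntertwining' g).symm

end Representation


/-- If `ρ₁, ρ₂ : G → GL(n, ℂ)` are inequivalent representations of a finite group `G`,
then the number of `g ∈ G` with `Tr ρ₁(g) = Tr ρ₂(g)` is at most `(1 - 1/(2n²))·|G|`. -/
theorem stmt0 (n : ℕ) (hn : 1 ≤ n) (G : Type*) [Group G] [Fintype G] [DecidableEq G]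
    (ρ₁ ρ₂ : G →* Matrix.GeneralLinearGroup (Fin n) ℂ)
    (hineq : ¬ ∃ M : Matrix.GeneralLinearGroup (Fin n) ℂ,
      ∀ g : G, (ρ₂ g : Matrix (Fin n) (Fin n) ℂ)
        = (M : Matrix (Fin n) (Fin n) ℂ) * (ρ₁ g : Matrix (Fin n) (Fin n) ℂ)
            * (M⁻¹ : Matrix.GeneralLinearGroup (Fin n) ℂ) ) :
    ((Finset.univ.filter fun g : G =>
        Matrix.trace (ρ₁ g : Matrix (Fin n) (Fin n) ℂ)
          = Matrix.trace (ρ₂ g : Matrix (Fin n) (Fin n) ℂ)).card : ℝ)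
      ≤ (1 - 1 / (2 * (n : ℝ) ^ 2)) * (Fintype.card G : ℝ) := by
  have hne : IsEmpty ((Representation.ofGeneralLinearGroup ρ₁).Equiv
      (Representation.ofGeneralLinearGroup ρ₂)) := ⟨fun e => by
    obtain ⟨M, hM⟩ := Representation.exists_conj_of_equiv_ofGeneralLinearGroup e
    exact hineq ⟨M, fun g => by rw [hM g]; rfl⟩⟩
  obtain ⟨m, hm, hsum⟩ := Representation.exists_two_le_sum_sub_mul_sub_inv _ _ rfl hne
  simp only [Representation.character_ofGeneralLinearGroup] at hsum
  have htrace : ∀ (ρ : G →* Matrix.GeneralLinearGroup (Fin n) ℂ) (g : G),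
      ‖Matrix.trace (ρ g : Matrix (Fin n) (Fin n) ℂ)‖ ≤ n := fun ρ g =>
    Matrix.norm_trace_le_of_pow_eq_one (Fintype.card_ne_zero (α := G)) <| by
      rw [← Units.val_pow_eq_pow_val, ← map_pow, pow_card_eq_one, map_one, Units.val_one]
  have hdiff : ∀ g : G, ‖Matrix.trace (ρ₁ g : Matrix (Fin n) (Fin n) ℂ)
      - Matrix.trace (ρ₂ g : Matrix (Fin n) (Fin n) ℂ)‖ ≤ 2 * n := fun g =>
    (norm_sub_le _ _).trans (by linarith [htrace ρ₁ g, htrace ρ₂ g])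
  set P : G → Prop := fun g => Matrix.trace (ρ₁ g : Matrix (Fin n) (Fin n) ℂ)
    = Matrix.trace (ρ₂ g : Matrix (Fin n) (Fin n) ℂ)
  have hcard : ((Finset.univ.filter P).card : ℝ) + ((Finset.univ.filter fun g => ¬ P g).card : ℝ)
      = Fintype.card G := by
    exact_mod_cast Finset.card_filter_add_card_filter_not (s := Finset.univ) P
  have hbound : (Fintype.card G : ℝ) * 2 ≤
      ((Finset.univ.filter fun g => ¬ P g).card : ℝ) * (4 * (n : ℝ) ^ 2) := by
    calc (Fintype.card G : ℝ) * 2 ≤ Fintype.card G * m := by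
          gcongr; exact_mod_cast hm
      _ = ‖(Fintype.card G : ℂ) * m‖ := by simp
      _ ≤ ∑ g : G, if P g then 0 else 4 * (n : ℝ) ^ 2 := by
          rw [← hsum]
          refine norm_sum_le_of_le _ fun g _ => ?_
          split_ifs with hg
          · rw [sub_eq_zero.2 hg, zero_mul, norm_zero]
          · rw [norm_mul]
            calc _ ≤ (2 * n : ℝ) * (2 * n) :=
                  mul_le_mul (hdiff g) (hdiff g⁻¹) (norm_nonneg _) (by positivity)
              _ = _ := by ring
      _ = _ := by
          rw [Finset.sum_ite, Finset.sum_const_zero, zero_add, Finset.sum_const, nsmul_eq_mul]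
  have hn2 : (0 : ℝ) < 2 * (n : ℝ) ^ 2 := by positivity
  have hdiv : (Fintype.card G : ℝ) / (2 * (n : ℝ) ^ 2)
      ≤ ((Finset.univ.filter fun g => ¬ P g).card : ℝ) := by
    rw [div_le_iff₀ hn2]; linarith
  rw [sub_mul, one_mul, one_div_mul_eq_div]
  linarith
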